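/- Let E be a real inner product space, N ≥ 1, and let L_1, …, L_N : E → ℝ be differentiable functions, each with L_F-Lipschitz gradient (L_F > 0). Let L = (1/N)∑_{i=1}^N L_i and suppose the bounded-variance condition holds with constant δ_L: (1/N)∑_{i=1}^N ‖∇L_i(ν) − ∇L(ν)‖² ≤ δ_L² for every ν ∈ E. Let 0 < α ≤ 1, let R ≥ 1 be an integer, let γ > 0, set γ̂ = αγR, and assume γ̂ ≤ α/(√(32(R+3))·L_F). Fix ν_t ∈ E, define for each i the local iterates ν_{i,0}^t = ν_t and ν_{i,r+1}^t = ν_{i,r}^t − γ∇L_i(ν_{i,r}^t) for r = 0,…,R−1, and the server update ν_{t+1} = ν_t − α(ν_t − (1/N)∑_{i=1}^N ν_{i,R}^t). Then L(ν_{t+1}) ≤ L(ν_t) − (γ̂/4)·‖∇L(ν_t)‖² + 8γ̂³L_F²δ_L²/α² + 8(1+R)γ̂⁴L_F³δ_L²/α². -/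

import Mathlib

/-- `g` is the gradient of `f : E → ℝ` at `x`: the Fréchet derivative of `f` at `x`
is `y ↦ ⟪g, y⟫`. (Stated via `innerSL` so that no completeness of `E` is needed.) -/
def HasGradAt {E : Type*} [NormedAddCommGroup E] [InnerProductSpace ℝ E]
    (f : E → ℝ) (g x : E) : Prop :=
  HasFDerivAt f (innerSL ℝ g) x

/-- The global objective `L = (1/N) ∑ᵢ Lᵢ`. -/
noncomputable def avgFn {E : Type*} (N : ℕ) (Li : Fin N → E → ℝ) : E → ℝ :=
  fun ν => (N : ℝ)⁻¹ * ∑ i, Li i ν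

open scoped RealInnerProductSpace

/-- The descent lemma: a function with `K`-Lipschitz gradient is bounded above by its
quadratic model. -/
theorem HasGradAt.le_quadratic {E : Type*} [NormedAddCommGroup E] [InnerProductSpace ℝ E]
    {f : E → ℝ} {g : E → E} (hg : ∀ x, HasGradAt f (g x) x) {K : ℝ}
    (hLip : ∀ x y, ‖g x - g y‖ ≤ K * ‖x - y‖) (x d : E) :
    f (x + d) ≤ f x + ⟪g x, d⟫ + K / 2 * ‖d‖ ^ 2 := by
  let φ : ℝ → ℝ := fun t => f (x + t • d) - t * ⟪g x, d⟫ - K / 2 * ‖d‖ ^ 2 * t ^ 2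
  have hφ : ∀ t, HasDerivAt φ
      (⟪g (x + t • d), d⟫ - ⟪g x, d⟫ - K * ‖d‖ ^ 2 * t) t := by
    intro t
    have hline : HasDerivAt (fun t : ℝ => x + t • d) d t := by
      simpa using ((hasDerivAt_id t).smul_const d).const_add x
    have hf : HasDerivAt (fun t : ℝ => f (x + t • d)) ⟪g (x + t • d), d⟫ t :=
      HasFDerivAt.comp_hasDerivAt (f := fun t : ℝ => x + t • d) t (hg (x + t • d)) hline
    have hlin : HasDerivAt (fun t : ℝ => t * ⟪g x, d⟫) ⟪g x, d⟫ t := by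
      simpa using (hasDerivAt_id t).mul_const ⟪g x, d⟫
    have hquad : HasDerivAt (fun t : ℝ => K / 2 * ‖d‖ ^ 2 * t ^ 2) (K * ‖d‖ ^ 2 * t) t := by
      refine ((hasDerivAt_pow 2 t).const_mul (K / 2 * ‖d‖ ^ 2)).congr_deriv ?_
      push_cast
      ring
    exact (hf.sub hlin).sub hquad
  have hanti : AntitoneOn φ (Set.Ici 0) := by
    refine antitoneOn_of_deriv_nonpos (convex_Ici 0)
      (fun t _ => (hφ t).continuousAt.continuousWithinAt)
      (fun t _ => (hφ t).differentiableAt.differentiableWithinAt) fun t ht => ?_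
    rw [interior_Ici, Set.mem_Ioi] at ht
    rw [(hφ t).deriv, ← inner_sub_left]
    have hinner := real_inner_le_norm (g (x + t • d) - g x) d
    have hnorm := hLip (x + t • d) x
    rw [add_sub_cancel_left, norm_smul, Real.norm_of_nonneg ht.le] at hnorm
    nlinarith [mul_le_mul_of_nonneg_right hnorm (norm_nonneg d)]
  have h := hanti (Set.mem_Ici.2 le_rfl) (Set.mem_Ici.2 zero_le_one) zero_le_one
  simp only [φ, one_smul, zero_smul, add_zero] at h
  linarith

/-- The gradient of an average is the average of the gradients. -/
theorem HasGradAt.eq_average {E : Type*} [NormedAddCommGroup E] [InnerProductSpace ℝ E]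
    {N : ℕ} {Li : Fin N → E → ℝ} {gi : Fin N → E} {g x : E}
    (hgi : ∀ i, HasGradAt (Li i) (gi i) x) (hg : HasGradAt (avgFn N Li) g x) :
    g = (N : ℝ)⁻¹ • ∑ i, gi i := by
  have h : HasFDerivAt (avgFn N Li) ((N : ℝ)⁻¹ • ∑ i, innerSL ℝ (gi i)) x :=
    (HasFDerivAt.fun_sum fun i _ => hgi i).const_mul _
  refine ext_inner_right ℝ fun v => ?_
  simpa [inner_smul_left, sum_inner] using DFunLike.congr_fun (hg.unique h) v

theorem norm_average_le {E : Type*} [NormedAddCommGroup E] [InnerProductSpace ℝ E]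
    {N : ℕ} (v : Fin N → E) :
    ‖(N : ℝ)⁻¹ • ∑ i, v i‖ ≤ (N : ℝ)⁻¹ * ∑ i, ‖v i‖ := by
  rw [norm_smul, Real.norm_of_nonneg (by positivity)]
  gcongr
  exact norm_sum_le _ _

theorem average_const {N : ℕ} (hN : 1 ≤ N) (c : ℝ) :
    (N : ℝ)⁻¹ * ∑ _i : Fin N, c = c := by
  have : (N : ℝ) ≠ 0 := by positivity
  simp [this]

theorem sq_average_le {N : ℕ} (hN : 1 ≤ N) (a : Fin N → ℝ) :
    ((N : ℝ)⁻¹ * ∑ i, a i) ^ 2 ≤ (N : ℝ)⁻¹ * ∑ i, a i ^ 2 := by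
  have hN' : (0 : ℝ) < N := by positivity
  have h := sq_sum_le_card_mul_sum_sq (s := Finset.univ) (f := a)
  rw [Finset.card_univ, Fintype.card_fin] at h
  calc ((N : ℝ)⁻¹ * ∑ i, a i) ^ 2 = (N : ℝ)⁻¹ ^ 2 * (∑ i, a i) ^ 2 := by ring
    _ ≤ (N : ℝ)⁻¹ ^ 2 * (N * ∑ i, a i ^ 2) := by gcongr
    _ = (N : ℝ)⁻¹ * ∑ i, a i ^ 2 := by field_simp

/-- Gradient descent iterates stay within `2 γ r ‖g (x 0)‖` of the starting point as long as
the total step size is at most `1 / (2 K)`. -/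
theorem norm_gradientDescent_sub_le {E : Type*} [NormedAddCommGroup E] [InnerProductSpace ℝ E]
    {g : E → E} {K γ : ℝ} (hK : 0 ≤ K) (hγ : 0 ≤ γ)
    (hLip : ∀ x y, ‖g x - g y‖ ≤ K * ‖x - y‖) {x : ℕ → E}
    (hx : ∀ r, x (r + 1) = x r - γ • g (x r)) {R : ℕ} (hR : 2 * (γ * R * K) ≤ 1)
    {r : ℕ} (hr : r ≤ R) :
    ‖x r - x 0‖ ≤ 2 * γ * r * ‖g (x 0)‖ := by
  induction r with
  | zero => simp
  | succ r ih =>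
    have ih := ih (by omega)
    have hrR : (r : ℝ) ≤ R := by exact_mod_cast (by omega : r ≤ R)
    have hrK : 2 * (γ * r * K) ≤ 1 := le_trans (by gcongr) hR
    have hgrad : ‖g (x r)‖ ≤ 2 * ‖g (x 0)‖ := by
      calc ‖g (x r)‖ ≤ ‖g (x 0)‖ + ‖g (x r) - g (x 0)‖ := norm_le_insert' _ _
        _ ≤ ‖g (x 0)‖ + K * (2 * γ * r * ‖g (x 0)‖) := by
          gcongr
          exact (hLip _ _).trans (by gcongr)
        _ = ‖g (x 0)‖ + 2 * (γ * r * K) * ‖g (x 0)‖ := by ring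
        _ ≤ ‖g (x 0)‖ + 1 * ‖g (x 0)‖ := by gcongr
        _ = 2 * ‖g (x 0)‖ := by ring
    calc ‖x (r + 1) - x 0‖ = ‖(x r - x 0) - γ • g (x r)‖ := by rw [hx]; congr 1; abel
      _ ≤ ‖x r - x 0‖ + ‖γ • g (x r)‖ := norm_sub_le _ _
      _ = ‖x r - x 0‖ + γ * ‖g (x r)‖ := by rw [norm_smul, Real.norm_of_nonneg hγ]
      _ ≤ 2 * γ * r * ‖g (x 0)‖ + γ * (2 * ‖g (x 0)‖) := by gcongr
      _ = 2 * γ * (r + 1 : ℕ) * ‖g (x 0)‖ := by push_cast; ring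

/-- Comparison of `r` gradient descent steps with a single step of size `γ r`. -/
theorem norm_gradientDescent_sub_add_le {E : Type*} [NormedAddCommGroup E]
    [InnerProductSpace ℝ E] {g : E → E} {K γ : ℝ} (hK : 0 ≤ K) (hγ : 0 ≤ γ)
    (hLip : ∀ x y, ‖g x - g y‖ ≤ K * ‖x - y‖) {x : ℕ → E}
    (hx : ∀ r, x (r + 1) = x r - γ • g (x r)) {R : ℕ} (hR : 2 * (γ * R * K) ≤ 1)
    {r : ℕ} (hr : r ≤ R) :
    ‖x r - x 0 + (γ * r) • g (x 0)‖ ≤ γ * r * (K * (2 * γ * R * ‖g (x 0)‖)) := by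
  induction r with
  | zero => simp
  | succ r ih =>
    have ih := ih (by omega)
    have hrR : (r : ℝ) ≤ R := by exact_mod_cast (by omega : r ≤ R)
    have hdrift : ‖g (x 0) - g (x r)‖ ≤ K * (2 * γ * R * ‖g (x 0)‖) := by
      rw [norm_sub_rev]
      refine (hLip _ _).trans ?_
      gcongr
      exact (norm_gradientDescent_sub_le hK hγ hLip hx hR (by omega)).trans (by gcongr)
    calc ‖x (r + 1) - x 0 + (γ * (r + 1 : ℕ)) • g (x 0)‖
        = ‖(x r - x 0 + (γ * r) • g (x 0)) + γ • (g (x 0) - g (x r))‖ := by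
          rw [hx]
          congr 1
          push_cast
          module
      _ ≤ ‖x r - x 0 + (γ * r) • g (x 0)‖ + ‖γ • (g (x 0) - g (x r))‖ := norm_add_le _ _
      _ = ‖x r - x 0 + (γ * r) • g (x 0)‖ + γ * ‖g (x 0) - g (x r)‖ := by
          rw [norm_smul, Real.norm_of_nonneg hγ]
      _ ≤ γ * r * (K * (2 * γ * R * ‖g (x 0)‖)) + γ * (K * (2 * γ * R * ‖g (x 0)‖)) := by
          gcongr
      _ = γ * (r + 1 : ℕ) * (K * (2 * γ * R * ‖g (x 0)‖)) := by push_cast; ring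

/-- One step along an inexact gradient `g x + w`. -/
theorem HasGradAt.inexact_step_le {E : Type*} [NormedAddCommGroup E] [InnerProductSpace ℝ E]
    {f : E → ℝ} {g : E → E} (hg : ∀ x, HasGradAt f (g x) x) {K : ℝ}
    (hLip : ∀ x y, ‖g x - g y‖ ≤ K * ‖x - y‖) {η : ℝ} (hη : 0 ≤ η) (hηK : η * K ≤ 1)
    (x w : E) :
    f (x - η • (g x + w)) ≤ f x - η / 2 * ‖g x‖ ^ 2 + η / 2 * ‖w‖ ^ 2 := by
  have h := HasGradAt.le_quadratic hg hLip x (-(η • (g x + w)))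
  rw [← sub_eq_add_neg, inner_neg_right, inner_smul_right, inner_add_right,
    real_inner_self_eq_norm_sq, norm_neg, norm_smul, Real.norm_of_nonneg hη, mul_pow] at h
  have hexp := norm_add_sq_real (g x) w
  have hquad : K / 2 * (η ^ 2 * ‖g x + w‖ ^ 2) ≤ η / 2 * ‖g x + w‖ ^ 2 := by
    calc K / 2 * (η ^ 2 * ‖g x + w‖ ^ 2) = η * K * (η / 2 * ‖g x + w‖ ^ 2) := by ring
      _ ≤ 1 * (η / 2 * ‖g x + w‖ ^ 2) := by gcongr
      _ = η / 2 * ‖g x + w‖ ^ 2 := one_mul _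
  rw [hexp] at h hquad
  linarith

/-- the per-round descent inequality for the federated iterates:
under `L_F`-smoothness of every local objective, the bounded variance condition,
`0 < α ≤ 1`, `R ≥ 1`, and `γ̂ = αγR ≤ α/(√(32(R+3))·L_F)`, one round of the algorithm
satisfies `L(ν_{t+1}) ≤ L(ν_t) − (γ̂/4)‖∇L(ν_t)‖² + 8γ̂³L_F²δ_L²/α² + 8(1+R)γ̂⁴L_F³δ_L²/α²`. -/
theorem stmt8 {E : Type*} [NormedAddCommGroup E] [InnerProductSpace ℝ E]
    (N : ℕ) (hN : 1 ≤ N) (Li : Fin N → E → ℝ) (gi : Fin N → E → E)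
    (hgrad : ∀ i x, HasGradAt (Li i) (gi i x) x)
    (LF : ℝ) (hLF : 0 < LF)
    (hLip : ∀ i x y, ‖gi i x - gi i y‖ ≤ LF * ‖x - y‖)
    (gL : E → E) (hgL : ∀ x, HasGradAt (avgFn N Li) (gL x) x)
    (δL : ℝ)
    (hvar : ∀ ν : E, (N : ℝ)⁻¹ * ∑ i, ‖gi i ν - gL ν‖ ^ 2 ≤ δL ^ 2)
    (α : ℝ) (hα0 : 0 < α) (hα1 : α ≤ 1)
    (R : ℕ) (hR : 1 ≤ R) (γ : ℝ) (hγ : 0 < γ)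
    (γhat : ℝ) (hγhat : γhat = α * γ * (R : ℝ))
    (hγle : γhat ≤ α / (Real.sqrt (32 * ((R : ℝ) + 3)) * LF))
    (νt : E) (νloc : Fin N → ℕ → E)
    (hν0 : ∀ i, νloc i 0 = νt)
    (hνstep : ∀ i r, νloc i (r + 1) = νloc i r - γ • gi i (νloc i r))
    (νt1 : E) (hserver : νt1 = νt - α • (νt - (N : ℝ)⁻¹ • ∑ i, νloc i R)) :
    avgFn N Li νt1 ≤ avgFn N Li νt - (γhat / 4) * ‖gL νt‖ ^ 2
      + 8 * γhat ^ 3 * LF ^ 2 * δL ^ 2 / α ^ 2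
      + 8 * (1 + (R : ℝ)) * γhat ^ 4 * LF ^ 3 * δL ^ 2 / α ^ 2 := by
  have hgL_eq : ∀ x, gL x = (N : ℝ)⁻¹ • ∑ i, gi i x := fun x =>
    HasGradAt.eq_average (fun i => hgrad i x) (hgL x)
  have hgL_Lip : ∀ x y, ‖gL x - gL y‖ ≤ LF * ‖x - y‖ := by
    intro x y
    rw [hgL_eq, hgL_eq, ← smul_sub, ← Finset.sum_sub_distrib]
    refine (norm_average_le _).trans ?_
    rw [← average_const hN (LF * ‖x - y‖)]
    gcongr with i
    exact hLip i x y
  have hR' : (1 : ℝ) ≤ R := by exact_mod_cast hR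
  have hsmall : γ * R * LF ≤ 1 / 8 := by
    have hsqrt : (8 : ℝ) ≤ Real.sqrt (32 * ((R : ℝ) + 3)) :=
      Real.le_sqrt_of_sq_le (by linarith)
    have h8 : γhat ≤ α / (8 * LF) := hγle.trans (by gcongr)
    rw [le_div_iff₀ (by positivity), hγhat] at h8
    have : α * (γ * R * LF * 8) ≤ α * 1 := by linarith
    linarith [le_of_mul_le_mul_left this hα0]
  have hγhat0 : 0 < γhat := by rw [hγhat]; positivity
  have hγhatL : γhat * LF ≤ 1 := by
    calc γhat * LF = α * (γ * R * LF) := by rw [hγhat]; ring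
      _ ≤ 1 * (1 / 8) := by gcongr
      _ ≤ 1 := by norm_num
  -- The accumulated update is an inexact gradient step with error `w`.
  obtain ⟨w, hw⟩ : ∃ w, w = -(γ * R)⁻¹ •
      ((N : ℝ)⁻¹ • ∑ i, (νloc i R - νt + (γ * R) • gi i νt)) := ⟨_, rfl⟩
  have hstep : νt1 = νt - γhat • (gL νt + w) := by
    have hN' : (N : ℝ) ≠ 0 := by positivity
    have hs : γ * R ≠ 0 := by positivity
    have hsum : (N : ℝ)⁻¹ • ∑ i, (νloc i R - νt + (γ * R) • gi i νt) =
        (N : ℝ)⁻¹ • ∑ i, νloc i R - νt + (γ * R) • gL νt := by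
      rw [Finset.sum_add_distrib, Finset.sum_sub_distrib, ← Finset.smul_sum, smul_add, smul_sub,
        smul_comm (N : ℝ)⁻¹ (γ * R), ← hgL_eq]
      simp [← Nat.cast_smul_eq_nsmul ℝ, smul_smul, hN']
    rw [hw, hsum, hserver, hγhat, mul_assoc]
    match_scalars <;> field_simp
    ring
  have hw_le : ‖w‖ ≤ 2 * (γ * R * LF) * ((N : ℝ)⁻¹ * ∑ i, ‖gi i νt‖) := by
    have hlocal : ∀ i, ‖νloc i R - νt + (γ * R) • gi i νt‖ ≤
        γ * R * (LF * (2 * γ * R * ‖gi i νt‖)) := by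
      intro i
      have h := norm_gradientDescent_sub_add_le hLF.le hγ.le (hLip i) (hνstep i)
        (by linarith) (le_refl R)
      rwa [hν0] at h
    rw [hw, norm_smul, norm_neg, Real.norm_of_nonneg (by positivity)]
    calc (γ * R)⁻¹ * ‖(N : ℝ)⁻¹ • ∑ i, (νloc i R - νt + (γ * R) • gi i νt)‖
        ≤ (γ * R)⁻¹ * ((N : ℝ)⁻¹ * ∑ i, γ * R * (LF * (2 * γ * R * ‖gi i νt‖))) := by
          gcongr
          refine (norm_average_le _).trans ?_
          gcongr with i
          exact hlocal i
      _ = 2 * (γ * R * LF) * ((N : ℝ)⁻¹ * ∑ i, ‖gi i νt‖) := by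
          simp only [← Finset.mul_sum]
          field_simp
  have havg : ((N : ℝ)⁻¹ * ∑ i, ‖gi i νt‖) ^ 2 ≤ 2 * (‖gL νt‖ ^ 2 + δL ^ 2) := by
    have hle : (N : ℝ)⁻¹ * ∑ i, ‖gi i νt‖ ≤
        ‖gL νt‖ + (N : ℝ)⁻¹ * ∑ i, ‖gi i νt - gL νt‖ := by
      nth_rw 1 [← average_const hN ‖gL νt‖]
      rw [← mul_add, ← Finset.sum_add_distrib]
      gcongr with i
      exact norm_le_insert' _ _
    have hdev := (sq_average_le hN fun i => ‖gi i νt - gL νt‖).trans (hvar νt)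
    calc ((N : ℝ)⁻¹ * ∑ i, ‖gi i νt‖) ^ 2
        ≤ (‖gL νt‖ + (N : ℝ)⁻¹ * ∑ i, ‖gi i νt - gL νt‖) ^ 2 := by gcongr
      _ ≤ 2 * (‖gL νt‖ ^ 2 + ((N : ℝ)⁻¹ * ∑ i, ‖gi i νt - gL νt‖) ^ 2) := add_sq_le
      _ ≤ 2 * (‖gL νt‖ ^ 2 + δL ^ 2) := by gcongr
  have hw_sq : ‖w‖ ^ 2 ≤ 8 * (γ * R * LF) ^ 2 * (‖gL νt‖ ^ 2 + δL ^ 2) := by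
    calc ‖w‖ ^ 2 ≤ (2 * (γ * R * LF) * ((N : ℝ)⁻¹ * ∑ i, ‖gi i νt‖)) ^ 2 := by gcongr
      _ = 4 * (γ * R * LF) ^ 2 * ((N : ℝ)⁻¹ * ∑ i, ‖gi i νt‖) ^ 2 := by ring
      _ ≤ 4 * (γ * R * LF) ^ 2 * (2 * (‖gL νt‖ ^ 2 + δL ^ 2)) := by gcongr
      _ = 8 * (γ * R * LF) ^ 2 * (‖gL νt‖ ^ 2 + δL ^ 2) := by ring
  have hdescent := HasGradAt.inexact_step_le hgL hgL_Lip hγhat0.le hγhatL νt w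
  rw [← hstep] at hdescent
  have herror : γhat / 2 * ‖w‖ ^ 2 ≤
      γhat / 4 * ‖gL νt‖ ^ 2 + 8 * γhat ^ 3 * LF ^ 2 * δL ^ 2 / α ^ 2 := by
    have hdiv : 8 * γhat ^ 3 * LF ^ 2 * δL ^ 2 / α ^ 2 =
        8 * γhat * (γ * R * LF) ^ 2 * δL ^ 2 := by
      rw [hγhat]
      field_simp
    have hsq : (γ * R * LF) ^ 2 ≤ (1 / 8) ^ 2 := by gcongr
    calc γhat / 2 * ‖w‖ ^ 2
        ≤ γhat / 2 * (8 * (γ * R * LF) ^ 2 * (‖gL νt‖ ^ 2 + δL ^ 2)) := by gcongr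
      _ = 4 * γhat * (γ * R * LF) ^ 2 * ‖gL νt‖ ^ 2 +
          4 * γhat * (γ * R * LF) ^ 2 * δL ^ 2 := by ring
      _ ≤ 4 * γhat * (1 / 8) ^ 2 * ‖gL νt‖ ^ 2 +
          8 * γhat * (γ * R * LF) ^ 2 * δL ^ 2 := by
          gcongr
          norm_num
      _ ≤ γhat / 4 * ‖gL νt‖ ^ 2 + 8 * γhat ^ 3 * LF ^ 2 * δL ^ 2 / α ^ 2 := by
          rw [hdiv]
          have : 0 ≤ γhat * ‖gL νt‖ ^ 2 := by positivity
          linarith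
  have hslack : 0 ≤ 8 * (1 + (R : ℝ)) * γhat ^ 4 * LF ^ 3 * δL ^ 2 / α ^ 2 := by positivity
  linarith
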